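/- arXiv:1308.6069 — 11 statements merged into one kernel-verified Lean document; each statement's English description precedes it below -/
import Mathlib

section
/- Let ξ > 0 and γ > 0, and let f : ℝ → ℝ be a bounded continuous function. Then the limit as ρ → ∞ of ∫₀^∞ f(u) · (γ/ξ)·((ρ+1)/γ)^(ρ+1)/Γ(ρ+1) · u^(ρ−1)·exp(−(ρ+1)·u/γ) du equals f(γ)/ξ; that is, the generalized Gamma Lévy measures converge weakly to (1/ξ) times the Dirac measure at γ as ρ → ∞. -/
open Filter Topology Set MeasureTheory

/-- A bounded continuous function deviates from its value at `a` by at most `ε` plus a multiple of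
the squared distance to `a`. -/
lemma exists_abs_sub_le_add_mul_sq {f : ℝ → ℝ} (hf : Continuous f) (hfb : ∃ C, ∀ u, |f u| ≤ C)
    (a : ℝ) {ε : ℝ} (hε : 0 < ε) :
    ∃ M, ∀ u, |f u - f a| ≤ ε + M * (u - a) ^ 2 := by
  obtain ⟨C, hC⟩ := hfb
  have hC0 : 0 ≤ C := (abs_nonneg _).trans (hC a)
  obtain ⟨δ, hδ, h⟩ := Metric.continuous_iff.1 hf a ε hε
  refine ⟨2 * C / δ ^ 2, fun u => ?_⟩
  by_cases hu : |u - a| < δ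
  · have := h u hu
    rw [Real.dist_eq] at this
    have h2 : 0 ≤ 2 * C / δ ^ 2 * (u - a) ^ 2 := by positivity
    linarith
  · have h1 : |f u - f a| ≤ 2 * C := by
      have := abs_sub (f u) (f a)
      linarith [hC u, hC a]
    have h2 : δ ^ 2 ≤ (u - a) ^ 2 := by
      rw [← sq_abs (u - a)]
      exact pow_le_pow_left₀ hδ.le (not_lt.1 hu) 2
    have h3 : 2 * C ≤ 2 * C / δ ^ 2 * (u - a) ^ 2 := by
      rw [div_mul_eq_mul_div, le_div_iff₀ (by positivity)]
      exact mul_le_mul_of_nonneg_left h2 (by positivity)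
    linarith

lemma integrableOn_rpow_sub_one_mul_exp_neg_mul_Ioi {s b : ℝ} (hs : 0 < s) (hb : 0 < b) :
    IntegrableOn (fun u : ℝ => u ^ (s - 1) * Real.exp (-(b * u))) (Ioi 0) := by
  by_contra h
  have h1 := integral_undef h
  rw [Real.integral_rpow_mul_exp_neg_mul_Ioi hs hb] at h1
  have := Real.Gamma_pos_of_pos hs
  have h2 : 0 < (1 / b) ^ s * Real.Gamma s := by positivity
  exact h2.ne' h1

/-- The generalized Gamma Lévy density with parameters `ξ`, `γ`, `ρ`. -/
noncomputable def genGammaLevyDensity (ξ γ ρ u : ℝ) : ℝ :=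
  (γ / ξ) * ((ρ + 1) / γ) ^ (ρ + 1) / Real.Gamma (ρ + 1) * u ^ (ρ - 1) *
    Real.exp (-((ρ + 1) * u / γ))

section

variable {ξ γ ρ : ℝ}

lemma genGammaLevyDensity_nonneg (hξ : 0 < ξ) (hγ : 0 < γ) (hρ : 0 < ρ) {u : ℝ} (hu : 0 < u) :
    0 ≤ genGammaLevyDensity ξ γ ρ u := by
  have := Real.Gamma_pos_of_pos (show 0 < ρ + 1 by linarith)
  unfold genGammaLevyDensity
  positivity

lemma pow_mul_genGammaLevyDensity (n : ℕ) {u : ℝ} (hu : 0 < u) :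
    u ^ n * genGammaLevyDensity ξ γ ρ u =
      (γ / ξ) * ((ρ + 1) / γ) ^ (ρ + 1) / Real.Gamma (ρ + 1) *
        (u ^ (ρ + n - 1) * Real.exp (-((ρ + 1) / γ * u))) := by
  have h : u ^ (ρ + n - 1) = u ^ (ρ - 1) * u ^ n := by
    rw [← Real.rpow_natCast u n, ← Real.rpow_add hu]
    ring_nf
  rw [genGammaLevyDensity, h, div_mul_eq_mul_div (ρ + 1) γ u]
  ring

lemma integrableOn_pow_mul_genGammaLevyDensity (hγ : 0 < γ) (hρ : 0 < ρ) (n : ℕ) :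
    IntegrableOn (fun u => u ^ n * genGammaLevyDensity ξ γ ρ u) (Ioi 0) := by
  refine IntegrableOn.congr_fun ?_ (fun u hu => (pow_mul_genGammaLevyDensity n hu).symm)
    measurableSet_Ioi
  exact (integrableOn_rpow_sub_one_mul_exp_neg_mul_Ioi (by positivity) (by positivity)).const_mul _

lemma integral_pow_mul_genGammaLevyDensity (hγ : 0 < γ) (hρ : 0 < ρ) (n : ℕ) :
    ∫ u in Ioi (0 : ℝ), u ^ n * genGammaLevyDensity ξ γ ρ u =
      (γ / ξ) * (ρ + 1) / γ * (γ / (ρ + 1)) ^ n * (Real.Gamma (ρ + n) / Real.Gamma (ρ + 1)) := by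
  have hb : 0 < (ρ + 1) / γ := by positivity
  rw [setIntegral_congr_fun measurableSet_Ioi (fun u hu => pow_mul_genGammaLevyDensity n hu),
    integral_const_mul, Real.integral_rpow_mul_exp_neg_mul_Ioi (by positivity) hb, one_div,
    Real.inv_rpow hb.le, Real.rpow_add hb, Real.rpow_add hb, Real.rpow_natCast, Real.rpow_one,
    ← inv_div (ρ + 1) γ, inv_pow]
  have := (Real.rpow_pos_of_pos hb ρ).ne'
  field_simp

lemma integrableOn_genGammaLevyDensity (hγ : 0 < γ) (hρ : 0 < ρ) :
    IntegrableOn (genGammaLevyDensity ξ γ ρ) (Ioi 0) := by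
  simpa using integrableOn_pow_mul_genGammaLevyDensity (ξ := ξ) hγ hρ 0

lemma integral_genGammaLevyDensity (hγ : 0 < γ) (hρ : 0 < ρ) :
    ∫ u in Ioi (0 : ℝ), genGammaLevyDensity ξ γ ρ u = 1 / ξ + 1 / ξ / ρ := by
  have h := integral_pow_mul_genGammaLevyDensity (ξ := ξ) hγ hρ 0
  have hG := (Real.Gamma_pos_of_pos hρ).ne'
  simp only [pow_zero, one_mul, Nat.cast_zero, add_zero, Real.Gamma_add_one hρ.ne'] at h
  rw [h]
  field_simp

lemma sub_sq_mul_eq (a u w : ℝ) :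
    (u - a) ^ 2 * w = u ^ 2 * w - 2 * a * (u ^ 1 * w) + a ^ 2 * w := by
  ring

lemma integrableOn_sub_sq_mul_genGammaLevyDensity (hγ : 0 < γ) (hρ : 0 < ρ) :
    IntegrableOn (fun u => (u - γ) ^ 2 * genGammaLevyDensity ξ γ ρ u) (Ioi 0) := by
  simp only [sub_sq_mul_eq]
  exact ((integrableOn_pow_mul_genGammaLevyDensity hγ hρ 2).sub
    ((integrableOn_pow_mul_genGammaLevyDensity hγ hρ 1).const_mul _)).add
    ((integrableOn_genGammaLevyDensity hγ hρ).const_mul _)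

lemma integral_sub_sq_mul_genGammaLevyDensity (hγ : 0 < γ) (hρ : 0 < ρ) :
    ∫ u in Ioi (0 : ℝ), (u - γ) ^ 2 * genGammaLevyDensity ξ γ ρ u = γ ^ 2 / ξ / ρ := by
  have i0 := integrableOn_genGammaLevyDensity (ξ := ξ) hγ hρ
  have i1 := integrableOn_pow_mul_genGammaLevyDensity (ξ := ξ) hγ hρ 1
  have i2 := integrableOn_pow_mul_genGammaLevyDensity (ξ := ξ) hγ hρ 2
  have hG := (Real.Gamma_pos_of_pos (show 0 < ρ + 1 by linarith)).ne'
  have h2 : Real.Gamma (ρ + 2) = (ρ + 1) * Real.Gamma (ρ + 1) := by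
    rw [← Real.Gamma_add_one (by positivity)]
    ring_nf
  simp only [sub_sq_mul_eq]
  rw [integral_add (by exact i2.sub (i1.const_mul _)) (i0.const_mul _),
    integral_sub i2 (i1.const_mul _),
    integral_const_mul, integral_const_mul, integral_pow_mul_genGammaLevyDensity hγ hρ,
    integral_pow_mul_genGammaLevyDensity hγ hρ, integral_genGammaLevyDensity hγ hρ]
  push_cast
  rw [h2]
  field_simp
  ring

lemma abs_integral_mul_genGammaLevyDensity_sub_le (hξ : 0 < ξ) (hγ : 0 < γ) (hρ : 0 < ρ)
    {f : ℝ → ℝ} (hf : Continuous f) (hfb : ∃ C, ∀ u, |f u| ≤ C) {ε M : ℝ}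
    (hM : ∀ u, |f u - f γ| ≤ ε + M * (u - γ) ^ 2) :
    |(∫ u in Ioi (0 : ℝ), f u * genGammaLevyDensity ξ γ ρ u) - f γ / ξ| ≤
      ε / ξ + (ε / ξ + M * γ ^ 2 / ξ + |f γ| / ξ) / ρ := by
  obtain ⟨C, hC⟩ := hfb
  have i0 := integrableOn_genGammaLevyDensity (ξ := ξ) hγ hρ
  have i2 := integrableOn_sub_sq_mul_genGammaLevyDensity (ξ := ξ) hγ hρ
  have hi : IntegrableOn (fun u => f u * genGammaLevyDensity ξ γ ρ u) (Ioi 0) :=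
    i0.bdd_mul hf.aestronglyMeasurable (ae_of_all _ hC)
  have key : ‖∫ u in Ioi (0 : ℝ), (f u * genGammaLevyDensity ξ γ ρ u -
      f γ * genGammaLevyDensity ξ γ ρ u)‖ ≤
      ∫ u in Ioi (0 : ℝ), (ε * genGammaLevyDensity ξ γ ρ u +
        M * ((u - γ) ^ 2 * genGammaLevyDensity ξ γ ρ u)) := by
    refine norm_integral_le_of_norm_le ((i0.const_mul _).add (i2.const_mul _)) ?_
    refine (ae_restrict_iff' measurableSet_Ioi).2 (ae_of_all _ fun u hu => ?_)
    have hw := genGammaLevyDensity_nonneg hξ hγ hρ hu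
    rw [← sub_mul, Real.norm_eq_abs, abs_mul, abs_of_nonneg hw]
    exact (mul_le_mul_of_nonneg_right (hM u) hw).trans_eq (by ring)
  rw [integral_sub hi (i0.const_mul _), integral_add (i0.const_mul _) (i2.const_mul _),
    integral_const_mul, integral_const_mul, integral_const_mul,
    integral_genGammaLevyDensity hγ hρ, integral_sub_sq_mul_genGammaLevyDensity hγ hρ,
    Real.norm_eq_abs] at key
  have hmass : |f γ * (1 / ξ + 1 / ξ / ρ) - f γ / ξ| = |f γ| / ξ / ρ := by
    rw [show f γ * (1 / ξ + 1 / ξ / ρ) - f γ / ξ = f γ / ξ / ρ by ring, abs_div, abs_div,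
      abs_of_pos hξ, abs_of_pos hρ]
  refine (abs_sub_le _ (f γ * (1 / ξ + 1 / ξ / ρ)) _).trans ?_
  exact (add_le_add key hmass.le).trans_eq (by ring)

end

/-- Let ξ > 0 and γ > 0, and let f : ℝ → ℝ be a bounded continuous function. Then the
limit as ρ → ∞ of ∫₀^∞ f(u) · (γ/ξ)·((ρ+1)/γ)^(ρ+1)/Γ(ρ+1) · u^(ρ−1)·exp(−(ρ+1)·u/γ) du
equals f(γ)/ξ: the generalized Gamma Lévy measures converge weakly to (1/ξ)·δ_γ
as ρ → ∞. -/
theorem gen_gamma_levy_measure_tendsto_dirac (ξ γ : ℝ) (hξ : 0 < ξ) (hγ : 0 < γ)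
    (f : ℝ → ℝ) (hf : Continuous f) (hfb : ∃ C, ∀ u, |f u| ≤ C) :
    Tendsto
      (fun ρ : ℝ =>
        ∫ u in Ioi (0 : ℝ),
          f u * ((γ / ξ) * ((ρ + 1) / γ) ^ (ρ + 1) / Real.Gamma (ρ + 1) * u ^ (ρ - 1) *
            Real.exp (-((ρ + 1) * u / γ))))
      atTop (𝓝 (f γ / ξ)) := by
  rw [Metric.tendsto_nhds]
  intro η hη
  obtain ⟨M, hM⟩ := exists_abs_sub_le_add_mul_sq hf hfb γ (show 0 < η * ξ / 2 by positivity)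
  have hlim : Tendsto (fun ρ : ℝ => (η * ξ / 2 / ξ + M * γ ^ 2 / ξ + |f γ| / ξ) / ρ) atTop (𝓝 0) :=
    tendsto_const_nhds.div_atTop tendsto_id
  filter_upwards [eventually_gt_atTop 0, hlim.eventually_lt_const (half_pos hη)] with ρ hρ hsmall
  have hle := abs_integral_mul_genGammaLevyDensity_sub_le hξ hγ hρ hf hfb hM
  have hη2 : η * ξ / 2 / ξ = η / 2 := by field_simp
  rw [Real.dist_eq]
  refine lt_of_le_of_lt hle ?_
  linarith
end

section
/- For every ξ > 0, γ > 0 and s > 0, the limit as ρ → ∞ of Φ_ρ(s) = ((ρ+1)/ξ)·log((1+ρ)/ρ − (1/ρ)·exp(−ρ·γ·s/(ρ+1))) equals (1/ξ)·(1 − exp(−γ·s)). -/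
open Filter Topology Set

/-- For every ξ > 0, γ > 0 and s > 0, the limit as ρ → ∞ of
Φ_ρ(s) = ((ρ+1)/ξ)·log((1+ρ)/ρ − (1/ρ)·exp(−ρ·γ·s/(ρ+1))) equals
(1/ξ)·(1 − exp(−γ·s)). -/
theorem phi_rho_tendsto_exp (ξ γ s : ℝ) (hξ : 0 < ξ) (hγ : 0 < γ) (hs : 0 < s) :
    Tendsto
      (fun ρ : ℝ =>
        ((ρ + 1) / ξ) * Real.log ((1 + ρ) / ρ - (1 / ρ) * Real.exp (-(ρ * γ * s / (ρ + 1)))))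
      atTop (𝓝 ((1 / ξ) * (1 - Real.exp (-(γ * s))))) := by
  have h_ratio : Tendsto (fun ρ : ℝ => 1 + ρ⁻¹) atTop (𝓝 1) := by
    simpa using (tendsto_const_nhds (x := (1 : ℝ))).add tendsto_inv_atTop_zero
  have h_exp : Tendsto (fun ρ : ℝ => 1 - Real.exp (-(ρ * γ * s / (ρ + 1)))) atTop
      (𝓝 (1 - Real.exp (-(γ * s)))) := by
    have h_arg : Tendsto (fun ρ : ℝ => -(ρ * γ * s / (ρ + 1))) atTop (𝓝 (-(γ * s))) := by
      have h : Tendsto (fun ρ : ℝ => -(γ * s / (1 + ρ⁻¹))) atTop (𝓝 (-(γ * s / 1))) :=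
        (tendsto_const_nhds.div h_ratio one_ne_zero).neg
      rw [div_one] at h
      refine h.congr' ?_
      filter_upwards [eventually_gt_atTop 0] with ρ hρ
      field_simp
    exact ((Real.continuous_exp.tendsto _).comp h_arg).const_sub 1
  have h_log : Tendsto
      (fun ρ : ℝ => ρ * Real.log (1 + (1 - Real.exp (-(ρ * γ * s / (ρ + 1)))) / ρ)) atTop
      (𝓝 (1 - Real.exp (-(γ * s)))) := by
    refine Real.tendsto_mul_log_one_add_of_tendsto (h_exp.congr' ?_)
    filter_upwards [eventually_gt_atTop 0] with ρ hρ
    rw [mul_div_cancel₀ _ hρ.ne']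
  have h_prod := (h_ratio.mul h_log).const_mul (1 / ξ)
  rw [one_mul] at h_prod
  refine h_prod.congr' ?_
  filter_upwards [eventually_gt_atTop 0] with ρ hρ
  have h_arg : (1 + ρ) / ρ - (1 / ρ) * Real.exp (-(ρ * γ * s / (ρ + 1))) =
      1 + (1 - Real.exp (-(ρ * γ * s / (ρ + 1)))) / ρ := by
    rw [add_div, div_self hρ.ne']
    ring
  rw [h_arg]
  have h_coeff : (ρ + 1) / ξ = 1 / ξ * ((1 + ρ⁻¹) * ρ) := by
    rw [add_mul, inv_mul_cancel₀ hρ.ne']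
    ring
  rw [h_coeff]
  ring
end

section
/- For every ξ > 0, γ > 0 and s > 0, the limit as ρ → 0+ of Φ_ρ(s) = ((ρ+1)/ξ)·log((1+ρ)/ρ − (1/ρ)·exp(−ρ·γ·s/(ρ+1))) equals (1/ξ)·log(1 + γ·s). -/
open Filter Topology Set

/-- For every ξ > 0, γ > 0 and s > 0, the limit as ρ → 0+ of
Φ_ρ(s) = ((ρ+1)/ξ)·log((1+ρ)/ρ − (1/ρ)·exp(−ρ·γ·s/(ρ+1))) equals (1/ξ)·log(1 + γ·s). -/
theorem phi_rho_tendsto_log (ξ γ s : ℝ) (hξ : 0 < ξ) (hγ : 0 < γ) (hs : 0 < s) :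
    Tendsto
      (fun ρ : ℝ =>
        ((ρ + 1) / ξ) * Real.log ((1 + ρ) / ρ - (1 / ρ) * Real.exp (-(ρ * γ * s / (ρ + 1)))))
      (𝓝[>] 0) (𝓝 ((1 / ξ) * Real.log (1 + γ * s))) := by
  have hg : HasDerivAt (fun ρ : ℝ => Real.exp (-(ρ * γ * s / (ρ + 1)))) (-(γ * s)) 0 := by
    have hnum : HasDerivAt (fun ρ : ℝ => ρ * γ * s) (1 * γ * s) 0 :=
      ((hasDerivAt_id' (0 : ℝ)).mul_const γ).mul_const s
    have hden : HasDerivAt (fun ρ : ℝ => ρ + 1) 1 0 := (hasDerivAt_id' (0 : ℝ)).add_const 1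
    have h := (hnum.fun_div hden (by norm_num)).fun_neg.exp
    convert h using 1
    simp
  have hslope := (hasDerivAt_iff_tendsto_slope_zero.mp hg).mono_left
    (nhdsWithin_mono (0 : ℝ) fun x (hx : 0 < x) => hx.ne')
  have harg : Tendsto
      (fun ρ : ℝ => (1 + ρ) / ρ - (1 / ρ) * Real.exp (-(ρ * γ * s / (ρ + 1))))
      (𝓝[>] 0) (𝓝 (1 + γ * s)) := by
    have h := hslope.const_sub 1
    rw [sub_neg_eq_add] at h
    refine h.congr' ?_
    filter_upwards [self_mem_nhdsWithin] with ρ hρ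
    have hρ0 : ρ ≠ 0 := ne_of_gt hρ
    simp only [zero_add, zero_mul, zero_div, neg_zero, Real.exp_zero, smul_eq_mul]
    generalize Real.exp (-(ρ * γ * s / (ρ + 1))) = e
    field_simp
    ring
  have hcoef : Tendsto (fun ρ : ℝ => (ρ + 1) / ξ) (𝓝[>] 0) (𝓝 (1 / ξ)) := by
    have h : Continuous fun ρ : ℝ => (ρ + 1) / ξ := by fun_prop
    simpa using (h.tendsto 0).mono_left nhdsWithin_le_nhds
  exact hcoef.mul (harg.log (by positivity))
end

section
/- For every ξ > 0, γ > 0 and s ≥ 0, define D_ρ(s) = (γ/ξ) · ρ·exp(−ρ·γ·s/(ρ+1)) / ((1+ρ) − exp(−ρ·γ·s/(ρ+1))), which is the derivative of the CEL function Φ_ρ at s. Then lim_{ρ→∞} D_ρ(s) = (γ/ξ)·exp(−γ·s) and lim_{ρ→0+} D_ρ(s) = (γ/ξ)·1/(1 + γ·s). -/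
open Filter Topology Set

/-- For every ξ > 0, γ > 0 and s ≥ 0, with
D_ρ(s) = (γ/ξ)·ρ·exp(−ρ·γ·s/(ρ+1))/((1+ρ) − exp(−ρ·γ·s/(ρ+1))) (the derivative of the
CEL function Φ_ρ at s), we have lim_{ρ→∞} D_ρ(s) = (γ/ξ)·exp(−γ·s) and
lim_{ρ→0+} D_ρ(s) = (γ/ξ)·1/(1 + γ·s). -/
theorem phi_rho_deriv_limits (ξ γ s : ℝ) (hξ : 0 < ξ) (hγ : 0 < γ) (hs : 0 ≤ s) :
    Tendsto
      (fun ρ : ℝ =>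
        (γ / ξ) * (ρ * Real.exp (-(ρ * γ * s / (ρ + 1)))) /
          ((1 + ρ) - Real.exp (-(ρ * γ * s / (ρ + 1)))))
      atTop (𝓝 ((γ / ξ) * Real.exp (-(γ * s)))) ∧
    Tendsto
      (fun ρ : ℝ =>
        (γ / ξ) * (ρ * Real.exp (-(ρ * γ * s / (ρ + 1)))) /
          ((1 + ρ) - Real.exp (-(ρ * γ * s / (ρ + 1)))))
      (𝓝[>] 0) (𝓝 ((γ / ξ) * (1 / (1 + γ * s)))) := by
  constructor
  · have hexp : Tendsto (fun ρ : ℝ => Real.exp (-(ρ * γ * s / (ρ + 1)))) atTop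
        (𝓝 (Real.exp (-(γ * s)))) := by
      refine (Real.continuous_exp.tendsto _).comp ?_
      have hinv : Tendsto (fun ρ : ℝ => (ρ + 1)⁻¹) atTop (𝓝 0) :=
        tendsto_inv_atTop_zero.comp (tendsto_atTop_add_const_right _ _ tendsto_id)
      have hlim := (hinv.const_mul (γ * s)).sub_const (γ * s)
      rw [mul_zero, zero_sub] at hlim
      refine hlim.congr' ?_
      filter_upwards [eventually_gt_atTop 0] with ρ hρ
      have : ρ + 1 ≠ 0 := by positivity
      field_simp
      ring
    have hden := ((hexp.const_sub 1).mul tendsto_inv_atTop_zero).const_add 1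
    rw [mul_zero, add_zero] at hden
    have hlim := (hexp.const_mul (γ / ξ)).div hden one_ne_zero
    rw [div_one] at hlim
    refine hlim.congr' ?_
    filter_upwards [eventually_gt_atTop 0] with ρ hρ
    have hρ' : ρ ≠ 0 := hρ.ne'
    simp only [Pi.div_apply]
    rw [← mul_div_mul_left _ _ hρ']
    congr 1
    · ring
    · field_simp
      ring
  · have hinner : HasDerivAt (fun ρ : ℝ => ρ * γ * s / (ρ + 1)) (γ * s) 0 := by
      have h := (((hasDerivAt_id (0 : ℝ)).mul_const γ).mul_const s).fun_div
        ((hasDerivAt_id (0 : ℝ)).add_const 1) (by simp)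
      simpa using h
    have hexp : HasDerivAt (fun ρ : ℝ => Real.exp (-(ρ * γ * s / (ρ + 1)))) (-(γ * s)) 0 := by
      simpa using hinner.fun_neg.exp
    have hden : HasDerivAt (fun ρ : ℝ => (1 + ρ) - Real.exp (-(ρ * γ * s / (ρ + 1))))
        (1 + γ * s) 0 := by
      simpa using ((hasDerivAt_id (0 : ℝ)).const_add 1).fun_sub hexp
    have hslope := hden.tendsto_slope_zero_right
    have hnum : Tendsto (fun ρ : ℝ => (γ / ξ) * Real.exp (-(ρ * γ * s / (ρ + 1))))
        (𝓝[>] 0) (𝓝 (γ / ξ)) := by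
      simpa using (hexp.continuousAt.tendsto.mono_left nhdsWithin_le_nhds).const_mul (γ / ξ)
    have hpos : 1 + γ * s ≠ 0 := by positivity
    have hlim := hnum.div hslope hpos
    rw [mul_one_div]
    refine hlim.congr' ?_
    filter_upwards [self_mem_nhdsWithin] with ρ hρ
    have hρ' : ρ ≠ 0 := (mem_Ioi.mp hρ).ne'
    simp only [Pi.div_apply, zero_add, zero_mul, zero_div, neg_zero, Real.exp_zero, add_zero,
      sub_self, sub_zero, smul_eq_mul]
    rw [← mul_div_mul_left _ _ hρ', mul_inv_cancel_left₀ hρ']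
    congr 1
    ring
end

section
/- Let ξ > 0 and γ > 0, and let f : ℝ → ℝ be a bounded continuous function. Then the limit as ρ → ∞ of the sum over k = 1, 2, 3, … of ((ρ+1)/(ξ·k·(1+ρ)^k)) · f(k·ρ·γ/(ρ+1)) equals f(γ)/ξ; that is, the generalized Poisson Lévy measures converge weakly to (1/ξ) times the Dirac measure at γ as ρ → ∞. -/
open Filter Topology Set

/-- For `0 ≤ ρ`, the `k`-th term of the integral of a function bounded by `C` is at most
`C / ξ * (1 + ρ)⁻¹ ^ k`. -/
lemma abs_gen_poisson_levy_term_le {ξ C ρ : ℝ} (hξ : 0 < ξ) (hρ : 0 ≤ ρ) {y : ℝ}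
    (hy : |y| ≤ C) (k : ℕ) :
    |((ρ + 1) / (ξ * (k + 1 : ℕ) * (1 + ρ) ^ (k + 1))) * y| ≤ C / ξ * ((1 + ρ)⁻¹) ^ k := by
  have hρ' : 0 < 1 + ρ := by linarith
  have hk : (0 : ℝ) < (k + 1 : ℕ) := by positivity
  have hcoef : (ρ + 1) / (ξ * (k + 1 : ℕ) * (1 + ρ) ^ (k + 1)) =
      (ξ⁻¹ * ((1 + ρ)⁻¹) ^ k) * ((k + 1 : ℕ) : ℝ)⁻¹ := by
    rw [inv_pow, pow_succ, add_comm ρ 1]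
    field_simp
  have hinv : ((k + 1 : ℕ) : ℝ)⁻¹ ≤ 1 := inv_le_one_of_one_le₀ (by simp)
  have hnonneg : 0 ≤ ξ⁻¹ * ((1 + ρ)⁻¹) ^ k := by positivity
  rw [hcoef, abs_mul, abs_of_nonneg (by positivity)]
  calc _ ≤ (ξ⁻¹ * ((1 + ρ)⁻¹) ^ k) * C :=
        mul_le_mul (mul_le_of_le_one_right hnonneg hinv) hy (abs_nonneg y) hnonneg
    _ = C / ξ * ((1 + ρ)⁻¹) ^ k := by ring

/-- The atom `ρ * γ / (ρ + 1)` tends to `γ` as `ρ → ∞`. -/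
lemma tendsto_mul_div_add_one_atTop (γ : ℝ) :
    Tendsto (fun ρ : ℝ => ρ * γ / (ρ + 1)) atTop (𝓝 γ) := by
  have hinv : Tendsto (fun ρ : ℝ => (ρ + 1)⁻¹) atTop (𝓝 0) :=
    tendsto_inv_atTop_zero.comp (tendsto_atTop_add_const_right _ 1 tendsto_id)
  have hlim : Tendsto (fun ρ : ℝ => γ - γ * (ρ + 1)⁻¹) atTop (𝓝 γ) := by
    simpa using (hinv.const_mul γ).const_sub γ
  refine hlim.congr' ?_
  filter_upwards [eventually_ge_atTop 0] with ρ hρ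
  have : ρ + 1 ≠ 0 := by positivity
  field_simp
  ring

/-- Let ξ > 0 and γ > 0, and let f : ℝ → ℝ be a bounded continuous function. Then the
limit as ρ → ∞ of Σ_{k=1}^∞ ((ρ+1)/(ξ·k·(1+ρ)^k)) · f(k·ρ·γ/(ρ+1)) equals f(γ)/ξ:
the generalized Poisson Lévy measures converge weakly to (1/ξ)·δ_γ as ρ → ∞. -/
theorem gen_poisson_levy_measure_tendsto_dirac (ξ γ : ℝ) (hξ : 0 < ξ) (hγ : 0 < γ)
    (f : ℝ → ℝ) (hf : Continuous f) (hfb : ∃ C, ∀ u, |f u| ≤ C) :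
    Tendsto
      (fun ρ : ℝ =>
        ∑' k : ℕ,
          ((ρ + 1) / (ξ * (k + 1 : ℕ) * (1 + ρ) ^ (k + 1))) *
            f ((k + 1 : ℕ) * ρ * γ / (ρ + 1)))
      atTop (𝓝 (f γ / ξ)) := by
  obtain ⟨C, hC⟩ := hfb
  have hC0 : 0 ≤ C := (abs_nonneg _).trans (hC 0)
  have htsum : ∑' k : ℕ, (if k = 0 then f γ / ξ else 0) = f γ / ξ := tsum_ite_eq 0 _
  rw [← htsum]
  refine tendsto_tsum_of_dominated_convergence (bound := fun k : ℕ => C / ξ * (1 / 2) ^ k)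
    (summable_geometric_two.mul_left _) ?_ ?_
  · rintro (_ | k)
    · rw [if_pos rfl]
      refine (((hf.tendsto γ).comp (tendsto_mul_div_add_one_atTop γ)).div_const ξ).congr' ?_
      filter_upwards [eventually_ge_atTop 0] with ρ hρ
      have : 1 + ρ ≠ 0 := by positivity
      simp only [Function.comp_apply, zero_add, Nat.cast_one, one_mul, mul_one, pow_one,
        add_comm ρ 1]
      field_simp
    · rw [if_neg k.succ_ne_zero]
      have hinv : Tendsto (fun ρ : ℝ => (1 + ρ)⁻¹) atTop (𝓝 0) :=
        tendsto_inv_atTop_zero.comp (tendsto_atTop_add_const_left _ 1 tendsto_id)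
      refine squeeze_zero_norm' (a := fun ρ : ℝ => C / ξ * ((1 + ρ)⁻¹) ^ (k + 1)) ?_ ?_
      · filter_upwards [eventually_ge_atTop 0] with ρ hρ
        exact abs_gen_poisson_levy_term_le hξ hρ (hC _) (k + 1)
      · simpa using (hinv.pow (k + 1)).const_mul (C / ξ)
  · filter_upwards [eventually_ge_atTop 1] with ρ hρ k
    refine (abs_gen_poisson_levy_term_le hξ (by linarith) (hC _) k).trans ?_
    have : (1 + ρ)⁻¹ ≤ 1 / 2 := by
      rw [← one_div]
      exact one_div_le_one_div_of_le two_pos (by linarith)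
    gcongr
end

section
/- Let ξ > 0 and γ > 0, and let f : [0,∞) → ℝ be a bounded continuous function for which there exists C > 0 with |f(u)| ≤ C·u for all u ≥ 0. Then the limit as ρ → 0+ of the sum over k = 1, 2, 3, … of ((ρ+1)/(ξ·k·(1+ρ)^k)) · f(k·ρ·γ/(ρ+1)) equals ∫₀^∞ f(u) · (1/(ξ·u))·exp(−u/γ) du; that is, the generalized Poisson Lévy measures converge to the Gamma subordinator Lévy measure as ρ → 0+. -/
open Filter Topology Set MeasureTheory

theorem iUnion_Ico_natCast_mul {h : ℝ} (hh : 0 < h) :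
    ⋃ k : ℕ, Ico (k * h) ((k + 1) * h) = Ici (0 : ℝ) := by
  ext u
  simp only [mem_iUnion, mem_Ico, mem_Ici]
  constructor
  · rintro ⟨k, hk, -⟩
    exact le_trans (by positivity) hk
  · intro hu
    refine ⟨⌊u / h⌋₊, ?_, ?_⟩
    · rw [← le_div_iff₀ hh]
      exact Nat.floor_le (by positivity)
    · rw [← div_lt_iff₀ hh]
      exact Nat.lt_floor_add_one _

/-- The integral over the half-line of a step function with steps of width `h`. -/
theorem setIntegral_Ici_floor_div (a : ℕ → ℝ) {h : ℝ} (hh : 0 < h)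
    (ha : IntegrableOn (fun u : ℝ => a ⌊u / h⌋₊) (Ici 0)) :
    ∫ u in Ici (0 : ℝ), a ⌊u / h⌋₊ = ∑' k : ℕ, h * a k := by
  have hmono : Monotone fun k : ℕ => (k : ℝ) * h := fun m n hmn => by
    dsimp only
    gcongr
  have hdisj : Pairwise (Function.onFun Disjoint
      fun k : ℕ => Ico ((k : ℝ) * h) (((k : ℝ) + 1) * h)) := by
    simpa using hmono.pairwise_disjoint_on_Ico_succ
  rw [← iUnion_Ico_natCast_mul hh] at ha ⊢
  rw [integral_iUnion (fun _ => measurableSet_Ico) hdisj ha]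
  congr 1 with k
  have hcongr : EqOn (fun u : ℝ => a ⌊u / h⌋₊) (fun _ => a k)
      (Ico (k * h) ((k + 1) * h)) := by
    rintro u ⟨hku, huk⟩
    have hfloor : ⌊u / h⌋₊ = k := by
      rw [Nat.floor_eq_iff (div_nonneg (le_trans (by positivity) hku) hh.le)]
      exact ⟨(le_div_iff₀ hh).2 hku, (div_lt_iff₀ hh).2 huk⟩
    simp only [hfloor]
  rw [setIntegral_congr_fun measurableSet_Ico hcongr, setIntegral_const, Real.volume_real_Ico,
    smul_eq_mul, max_eq_left (by nlinarith)]
  ring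

theorem lt_floor_div_add_one_mul {h : ℝ} (hh : 0 < h) (u : ℝ) :
    u < ((⌊u / h⌋₊ + 1 : ℕ) : ℝ) * h := by
  rw [← div_lt_iff₀ hh]
  exact_mod_cast Nat.lt_floor_add_one _

theorem tendsto_floor_div_add_one_mul {ι : Type*} {l : Filter ι} {h : ι → ℝ}
    (hpos : ∀ᶠ i in l, 0 < h i) (hlim : Tendsto h l (𝓝 0)) {u : ℝ} (hu : 0 ≤ u) :
    Tendsto (fun i => ((⌊u / h i⌋₊ + 1 : ℕ) : ℝ) * h i) l (𝓝 u) := by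
  have hadd : Tendsto (fun i => u + h i) l (𝓝 u) := by simpa using hlim.const_add u
  refine tendsto_of_tendsto_of_tendsto_of_le_of_le' tendsto_const_nhds hadd ?_ ?_
  · filter_upwards [hpos] with i hi
    exact (lt_floor_div_add_one_mul hi u).le
  · filter_upwards [hpos] with i hi
    have hfloor := (le_div_iff₀ hi).1 (Nat.floor_le (div_nonneg hu hi.le))
    push_cast
    linarith

theorem tendsto_log_one_add_div_mesh {γ : ℝ} (hγ : γ ≠ 0) :
    Tendsto (fun ρ : ℝ => Real.log (1 + ρ) / (ρ * γ / (ρ + 1))) (𝓝[>] 0) (𝓝 (1 / γ)) := by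
  have hslope : Tendsto (fun ρ : ℝ => ρ⁻¹ * Real.log (1 + ρ)) (𝓝[>] 0) (𝓝 1) := by
    have hd : HasDerivAt Real.log 1 1 := by simpa using Real.hasDerivAt_log one_ne_zero
    simpa using hd.tendsto_slope_zero_right
  have hadd : Tendsto (fun ρ : ℝ => (ρ + 1) / γ) (𝓝[>] 0) (𝓝 (1 / γ)) := by
    have hc : ContinuousAt (fun ρ : ℝ => (ρ + 1) / γ) 0 := by fun_prop
    simpa [ContinuousAt] using hc.tendsto.mono_left nhdsWithin_le_nhds
  have hmul := hslope.mul hadd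
  rw [one_mul] at hmul
  refine hmul.congr' ?_
  filter_upwards [self_mem_nhdsWithin] with ρ (hρ : 0 < ρ)
  have : ρ + 1 ≠ 0 := by positivity
  field_simp

theorem one_div_le_log_one_add_div_mesh {γ ρ : ℝ} (hγ : 0 < γ) (hρ : 0 < ρ) :
    1 / γ ≤ Real.log (1 + ρ) / (ρ * γ / (ρ + 1)) := by
  have hlog := Real.one_sub_inv_le_log_of_pos (show 0 < 1 + ρ by positivity)
  rw [le_div_iff₀ (by positivity)]
  refine le_trans (le_of_eq ?_) hlog
  field_simp
  ring

/-- Let ξ > 0 and γ > 0, and let f be a bounded continuous function on [0,∞) with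
|f(u)| ≤ C·u for some C > 0 and all u ≥ 0. Then the limit as ρ → 0+ of
Σ_{k=1}^∞ ((ρ+1)/(ξ·k·(1+ρ)^k)) · f(k·ρ·γ/(ρ+1)) equals
∫₀^∞ f(u)·(1/(ξ·u))·exp(−u/γ) du: the generalized Poisson Lévy measures converge to
the Gamma subordinator Lévy measure as ρ → 0+. -/
theorem gen_poisson_levy_measure_tendsto_gamma (ξ γ : ℝ) (hξ : 0 < ξ) (hγ : 0 < γ)
    (f : ℝ → ℝ) (hf : ContinuousOn f (Ici 0)) (hfb : ∃ M, ∀ u ≥ (0 : ℝ), |f u| ≤ M)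
    (hfC : ∃ C > (0 : ℝ), ∀ u ≥ (0 : ℝ), |f u| ≤ C * u) :
    Tendsto
      (fun ρ : ℝ =>
        ∑' k : ℕ,
          ((ρ + 1) / (ξ * (k + 1 : ℕ) * (1 + ρ) ^ (k + 1))) *
            f ((k + 1 : ℕ) * ρ * γ / (ρ + 1)))
      (𝓝[>] 0)
      (𝓝 (∫ u in Ioi (0 : ℝ), f u * ((1 / (ξ * u)) * Real.exp (-(u / γ))))) := by
  obtain ⟨C, hC, hfC⟩ := hfC
  let h : ℝ → ℝ := fun ρ => ρ * γ / (ρ + 1)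
  let w : ℝ → ℝ → ℝ := fun ρ x =>
    (ρ + 1) * (f x * ((1 / (ξ * x)) * Real.exp (-(x * (Real.log (1 + ρ) / h ρ)))))
  let a : ℝ → ℕ → ℝ := fun ρ k => w ρ ((k + 1 : ℕ) * h ρ)
  have hh : ∀ ρ > 0, 0 < h ρ := fun ρ hρ => by dsimp only [h]; positivity
  have hhpos : ∀ᶠ ρ in 𝓝[>] (0 : ℝ), 0 < h ρ := by
    filter_upwards [self_mem_nhdsWithin] with ρ hρ using hh ρ hρ
  have hhlim : Tendsto h (𝓝[>] 0) (𝓝 0) := by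
    have hc : ContinuousAt h 0 := by
      dsimp only [h]
      fun_prop (disch := norm_num)
    simpa [ContinuousAt, h] using hc.tendsto.mono_left nhdsWithin_le_nhds
  have hmeas : ∀ ρ, Measurable fun u : ℝ => a ρ ⌊u / h ρ⌋₊ := fun ρ =>
    (measurable_from_nat (f := a ρ)).comp (Nat.measurable_floor.comp (measurable_id.div_const _))
  have hbound : ∀ ρ > 0, ∀ u > 0,
      ‖a ρ ⌊u / h ρ⌋₊‖ ≤ (ρ + 1) * (C / ξ) * Real.exp (-(1 / γ) * u) := by
    intro ρ hρ u hu
    have hux := lt_floor_div_add_one_mul (hh ρ hρ) u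
    dsimp only [a, w]
    set x := ((⌊u / h ρ⌋₊ + 1 : ℕ) : ℝ) * h ρ
    have hx : 0 < x := hu.trans hux
    have hlog : 1 / γ ≤ Real.log (1 + ρ) / h ρ := one_div_le_log_one_add_div_mesh hγ hρ
    have hexp : -(x * (Real.log (1 + ρ) / h ρ)) ≤ -(1 / γ) * u := by
      have : u * (1 / γ) ≤ x * (Real.log (1 + ρ) / h ρ) := by gcongr
      linarith
    rw [Real.norm_eq_abs, abs_mul, abs_mul, abs_mul, Real.abs_exp,
      abs_of_pos (show 0 < ρ + 1 by positivity), abs_of_pos (show 0 < 1 / (ξ * x) by positivity)]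
    calc (ρ + 1) * (|f x| * (1 / (ξ * x) * Real.exp (-(x * (Real.log (1 + ρ) / h ρ)))))
        ≤ (ρ + 1) * ((C * x) * (1 / (ξ * x) * Real.exp (-(1 / γ) * u))) := by
          gcongr
          exact hfC x hx.le
      _ = (ρ + 1) * (C / ξ) * Real.exp (-(1 / γ) * u) := by
          field_simp
  have hexpint : ∀ c : ℝ, IntegrableOn (fun u : ℝ => c * Real.exp (-(1 / γ) * u)) (Ioi 0) :=
    fun c => (exp_neg_integrableOn_Ioi 0 (by positivity)).const_mul c
  have hsum : ∀ ρ > 0, ∫ u in Ioi (0 : ℝ), a ρ ⌊u / h ρ⌋₊ =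
      ∑' k : ℕ, ((ρ + 1) / (ξ * (k + 1 : ℕ) * (1 + ρ) ^ (k + 1))) *
        f ((k + 1 : ℕ) * ρ * γ / (ρ + 1)) := by
    intro ρ hρ
    have hint : IntegrableOn (fun u : ℝ => a ρ ⌊u / h ρ⌋₊) (Ici 0) := by
      rw [integrableOn_Ici_iff_integrableOn_Ioi]
      refine (hexpint ((ρ + 1) * (C / ξ))).mono' (hmeas ρ).aestronglyMeasurable ?_
      filter_upwards [ae_restrict_mem measurableSet_Ioi] with u hu using hbound ρ hρ u hu
    rw [← integral_Ici_eq_integral_Ioi, setIntegral_Ici_floor_div (a ρ) (hh ρ hρ) hint]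
    congr 1 with k
    have hne : h ρ ≠ 0 := (hh ρ hρ).ne'
    have hexp : Real.exp (-((k + 1 : ℕ) * h ρ * (Real.log (1 + ρ) / h ρ))) =
        ((1 + ρ) ^ (k + 1))⁻¹ := by
      rw [mul_assoc, mul_div_cancel₀ _ hne, Real.exp_neg, Real.exp_nat_mul,
        Real.exp_log (by positivity)]
    have harg : ((k + 1 : ℕ) : ℝ) * ρ * γ / (ρ + 1) = (k + 1 : ℕ) * h ρ := by
      dsimp only [h]
      ring
    dsimp only [a, w]
    rw [hexp, harg]
    have : ((k + 1 : ℕ) : ℝ) ≠ 0 := by positivity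
    have : 1 + ρ ≠ 0 := by positivity
    field_simp
  have hlim : Tendsto (fun ρ => ∫ u in Ioi (0 : ℝ), a ρ ⌊u / h ρ⌋₊) (𝓝[>] 0)
      (𝓝 (∫ u in Ioi (0 : ℝ), f u * ((1 / (ξ * u)) * Real.exp (-(u / γ))))) := by
    refine tendsto_integral_filter_of_dominated_convergence _
      (Eventually.of_forall fun ρ => (hmeas ρ).aestronglyMeasurable) ?_
      (hexpint (2 * (C / ξ))) ?_
    · filter_upwards [Ioo_mem_nhdsGT (zero_lt_one (α := ℝ))] with ρ hρ
      filter_upwards [ae_restrict_mem measurableSet_Ioi] with u hu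
      refine (hbound ρ hρ.1 u hu).trans ?_
      gcongr
      linarith [hρ.2]
    · filter_upwards [ae_restrict_mem measurableSet_Ioi] with u (hu : 0 < u)
      have hx := tendsto_floor_div_add_one_mul hhpos hhlim hu.le
      have hfx := (hf.continuousAt (Ici_mem_nhds hu)).tendsto.comp hx
      have hinv := (tendsto_const_nhds (x := (1 : ℝ))).div (hx.const_mul ξ) (by positivity)
      have hexp := (Real.continuous_exp.tendsto _).comp
        (hx.mul (tendsto_log_one_add_div_mesh hγ.ne')).neg
      have hone : Tendsto (fun ρ : ℝ => ρ + 1) (𝓝[>] 0) (𝓝 1) := by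
        have hid : Tendsto id (𝓝[>] (0 : ℝ)) (𝓝 0) := tendsto_id.mono_left nhdsWithin_le_nhds
        simpa using hid.add_const 1
      have hmul := hone.mul (hfx.mul (hinv.mul hexp))
      rwa [one_mul, mul_one_div] at hmul
  refine hlim.congr' ?_
  filter_upwards [self_mem_nhdsWithin] with ρ hρ using hsum ρ hρ
end

section
/- Fix r > 0 and x > 0. Then the limit as p → 0+ of the sum over nonnegative integers k with k·p ≤ x of Γ(k + r)/(Γ(r)·Γ(k+1)) · p^r · (1−p)^k equals (1/Γ(r)) · ∫₀^x u^(r−1)·e^(−u) du. In other words, if X has the negative binomial distribution with parameters r and p, then p·X converges in distribution as p → 0+ to a Gamma random variable with shape r and scale 1. -/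
open Filter Topology Set

/-- The weight `e^(-m) m^k / k!` which the Poisson distribution of mean `m` gives to `k`. -/
noncomputable def poissonWeight (m : ℝ) (k : ℕ) : ℝ :=
  Real.exp (-m) * m ^ k / k.factorial

lemma poissonWeight_nonneg {m : ℝ} (hm : 0 ≤ m) (k : ℕ) : 0 ≤ poissonWeight m k := by
  unfold poissonWeight
  positivity

lemma continuous_poissonWeight (k : ℕ) : Continuous fun m => poissonWeight m k := by
  unfold poissonWeight
  fun_prop

lemma hasSum_poissonWeight (m : ℝ) : HasSum (poissonWeight m) 1 := by
  have h := (NormedSpace.expSeries_div_hasSum_exp m).mul_left (Real.exp (-m))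
  rw [← Real.exp_eq_exp_ℝ, ← Real.exp_add, neg_add_cancel, Real.exp_zero] at h
  exact h.congr_fun fun k => mul_div_assoc _ _ _

lemma succ_mul_poissonWeight_succ (m : ℝ) (k : ℕ) :
    ((k + 1 : ℕ) : ℝ) * poissonWeight m (k + 1) = m * poissonWeight m k := by
  unfold poissonWeight
  rw [Nat.factorial_succ, Nat.cast_mul, pow_succ]
  field_simp

lemma hasSum_mul_poissonWeight (m : ℝ) : HasSum (fun k : ℕ => k * poissonWeight m k) m := by
  rw [← hasSum_nat_add_iff' 1]
  simpa [-Nat.cast_add, succ_mul_poissonWeight_succ] using (hasSum_poissonWeight m).mul_left m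

lemma hasSum_sq_mul_poissonWeight (m : ℝ) :
    HasSum (fun k : ℕ => (k : ℝ) ^ 2 * poissonWeight m k) (m * (m + 1)) := by
  rw [← hasSum_nat_add_iff' 1]
  have h := ((hasSum_mul_poissonWeight m).add (hasSum_poissonWeight m)).mul_left m
  simp only [Finset.range_one, Finset.sum_singleton, Nat.cast_zero, ne_eq, OfNat.ofNat_ne_zero,
    not_false_eq_true, zero_pow, zero_mul, sub_zero]
  refine h.congr_fun fun k => ?_
  rw [sq, mul_assoc, succ_mul_poissonWeight_succ]
  push_cast
  ring

lemma hasSum_variance_poissonWeight (m : ℝ) :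
    HasSum (fun k : ℕ => ((k : ℝ) - m) ^ 2 * poissonWeight m k) m := by
  convert! ((hasSum_sq_mul_poissonWeight m).sub
    ((hasSum_mul_poissonWeight m).mul_left (2 * m))).add
    ((hasSum_poissonWeight m).mul_left (m ^ 2)) using 1
  · ext k
    ring
  · ring

/-- Chebyshev's inequality for a Poisson distribution. -/
lemma hasSum_indicator_poissonWeight_le {m c a : ℝ} (hm : 0 ≤ m) (hc : 0 < c) {s : Set ℕ}
    (hs : ∀ k ∈ s, c ≤ |(k : ℝ) - m|) (ha : HasSum (s.indicator (poissonWeight m)) a) :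
    a ≤ m / c ^ 2 := by
  refine hasSum_le (fun k => ?_) ha ((hasSum_variance_poissonWeight m).div_const (c ^ 2))
  have hw := poissonWeight_nonneg hm k
  by_cases hk : k ∈ s
  · rw [indicator_of_mem hk, le_div_iff₀ (by positivity), mul_comm]
    refine mul_le_mul_of_nonneg_right ?_ hw
    rw [← sq_abs ((k : ℝ) - m)]
    exact pow_le_pow_left₀ hc.le (hs k hk) 2
  · rw [indicator_of_notMem hk]
    positivity

lemma sum_poissonWeight_le {m c : ℝ} (hm : 0 ≤ m) (hc : 0 < c) {s : Finset ℕ}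
    (hs : ∀ k ∈ s, c ≤ |(k : ℝ) - m|) : ∑ k ∈ s, poissonWeight m k ≤ m / c ^ 2 :=
  hasSum_indicator_poissonWeight_le (s := s) hm hc hs
    (hasSum_subtype_iff_indicator.mp (s.hasSum (poissonWeight m)))

lemma sum_poissonWeight_le_one {m : ℝ} (hm : 0 ≤ m) (s : Finset ℕ) :
    ∑ k ∈ s, poissonWeight m k ≤ 1 :=
  sum_le_hasSum s (fun k _ => poissonWeight_nonneg hm k) (hasSum_poissonWeight m)

lemma one_sub_sum_poissonWeight_le {m c : ℝ} (hm : 0 ≤ m) (hc : 0 < c) {s : Finset ℕ}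
    (hs : ∀ k ∉ s, c ≤ |(k : ℝ) - m|) : 1 - ∑ k ∈ s, poissonWeight m k ≤ m / c ^ 2 := by
  refine hasSum_indicator_poissonWeight_le (s := (s : Set ℕ)ᶜ) hm hc (by simpa using hs) ?_
  rw [indicator_compl]
  exact (hasSum_poissonWeight m).sub
    (hasSum_subtype_iff_indicator.mp (s.hasSum (poissonWeight m)))

lemma mem_range_floor_div_iff {p x : ℝ} (hp : 0 < p) (hx : 0 ≤ x) (k : ℕ) :
    k ∈ Finset.range (⌊x / p⌋₊ + 1) ↔ (k : ℝ) * p ≤ x := by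
  rw [Finset.mem_range, Nat.lt_succ_iff, Nat.le_floor_iff (by positivity), le_div_iff₀ hp]

/-- The Poisson distribution of mean `u (1 - p) / p`, scaled by `p`, concentrates at `u`. -/
lemma tendsto_sum_poissonWeight {u x : ℝ} (hu : 0 < u) (hx : 0 < x) (hux : u ≠ x) :
    Tendsto (fun p : ℝ => ∑ k ∈ Finset.range (⌊x / p⌋₊ + 1), poissonWeight (u * ((1 - p) / p)) k)
      (𝓝[>] 0) (𝓝 ((Iic x).indicator 1 u)) := by
  set d := |u - x| with hd
  have hd0 : 0 < d := abs_pos.mpr (sub_ne_zero.mpr hux)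
  have hlim : Tendsto (fun p : ℝ => 4 * u / d ^ 2 * p) (𝓝[>] 0) (𝓝 0) := by
    have : Continuous fun p : ℝ => 4 * u / d ^ 2 * p := by fun_prop
    simpa using (this.tendsto 0).mono_left nhdsWithin_le_nhds
  refine tendsto_iff_dist_tendsto_zero.mpr
    (squeeze_zero' (Eventually.of_forall fun _ => dist_nonneg) ?_ hlim)
  have hsmall : Ioo (0 : ℝ) (min 1 (d / (2 * u))) ∈ 𝓝[>] 0 :=
    Ioo_mem_nhdsGT (by positivity)
  filter_upwards [hsmall] with p ⟨hp, hp'⟩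
  obtain ⟨hp1, hp2⟩ := lt_min_iff.mp hp'
  rw [lt_div_iff₀ (by positivity)] at hp2
  have hm : 0 ≤ u * ((1 - p) / p) := mul_nonneg hu.le (div_nonneg (by linarith) hp.le)
  have hc : 0 < d / (2 * p) := by positivity
  have hbound : u * ((1 - p) / p) / (d / (2 * p)) ^ 2 ≤ 4 * u / d ^ 2 * p := by
    have : u * ((1 - p) / p) / (d / (2 * p)) ^ 2 = 4 * u / d ^ 2 * p * (1 - p) := by
      field_simp
      ring
    rw [this]
    exact mul_le_of_le_one_right (by positivity) (by linarith)
  have hdist (k : ℕ) : |(k : ℝ) - u * ((1 - p) / p)| = |k * p - u * (1 - p)| / p := by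
    rw [← abs_of_pos hp, ← abs_div, abs_of_pos hp]
    congr 1
    field_simp
  have hle (k : ℕ) (h : d ≤ 2 * |k * p - u * (1 - p)|) :
      d / (2 * p) ≤ |(k : ℝ) - u * ((1 - p) / p)| := by
    rw [hdist, div_le_div_iff₀ (by positivity) hp]
    nlinarith
  refine le_trans ?_ hbound
  rw [Real.dist_eq]
  rcases lt_or_gt_of_ne hux with h | h
  · rw [indicator_of_mem (mem_Iic.mpr h.le), Pi.one_apply, abs_sub_comm,
      abs_of_nonneg (sub_nonneg.mpr (sum_poissonWeight_le_one hm _))]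
    refine one_sub_sum_poissonWeight_le hm hc fun k hk => hle k ?_
    rw [mem_range_floor_div_iff hp hx.le, not_le] at hk
    rw [hd, abs_of_neg (sub_neg.mpr h)]
    have := le_abs_self (k * p - u * (1 - p))
    nlinarith [mul_pos hu hp]
  · rw [indicator_of_notMem (by simpa using h), sub_zero,
      abs_of_nonneg (Finset.sum_nonneg fun k _ => poissonWeight_nonneg hm k)]
    refine sum_poissonWeight_le hm hc fun k hk => hle k ?_
    rw [mem_range_floor_div_iff hp hx.le] at hk
    rw [abs_of_pos (sub_pos.mpr h)] at hd
    have := neg_le_abs (k * p - u * (1 - p))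
    nlinarith [mul_pos hu hp]

lemma integrableOn_rpow_mul_exp_neg {r : ℝ} (hr : 0 < r) :
    MeasureTheory.IntegrableOn (fun u : ℝ => u ^ (r - 1) * Real.exp (-u)) (Ioi 0) := by
  simpa only [mul_comm] using Real.GammaIntegral_convergent hr

lemma integrableOn_gamma_mul_poissonWeight {r c : ℝ} (hr : 0 < r) (hc : 0 ≤ c) (k : ℕ) :
    MeasureTheory.IntegrableOn
      (fun u : ℝ => u ^ (r - 1) * Real.exp (-u) * poissonWeight (u * c) k) (Ioi 0) := by
  refine (integrableOn_rpow_mul_exp_neg hr).mul_bdd (c := 1)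
    ((continuous_poissonWeight k).comp (by fun_prop)).aestronglyMeasurable ?_
  filter_upwards [MeasureTheory.ae_restrict_mem measurableSet_Ioi] with u hu
  have hm : 0 ≤ u * c := mul_nonneg (mem_Ioi.mp hu).le hc
  rw [Real.norm_of_nonneg (poissonWeight_nonneg hm k)]
  simpa using sum_poissonWeight_le_one hm {k}

/-- The negative binomial distribution is a mixture of Poisson distributions whose mean has a
Gamma distribution. -/
lemma integral_gamma_mul_poissonWeight {r p : ℝ} (hr : 0 < r) (hp : 0 < p) (k : ℕ) :
    ∫ u in Ioi (0 : ℝ), u ^ (r - 1) * Real.exp (-u) * poissonWeight (u * ((1 - p) / p)) k =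
      Real.Gamma (k + r) / Real.Gamma (k + 1) * p ^ r * (1 - p) ^ k := by
  have hint := Real.integral_rpow_mul_exp_neg_mul_Ioi (a := k + r) (r := 1 / p)
    (by positivity) (by positivity)
  calc
    _ = ∫ u in Ioi (0 : ℝ), ((1 - p) / p) ^ k / k.factorial *
        (u ^ (k + r - 1) * Real.exp (-(1 / p * u))) := by
      refine MeasureTheory.setIntegral_congr_fun measurableSet_Ioi fun u hu => ?_
      have hexp : Real.exp (-(1 / p * u)) = Real.exp (-u) * Real.exp (-(u * ((1 - p) / p))) := by
        rw [← Real.exp_add]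
        congr 1
        field_simp
        ring
      have hpow : u ^ (k + r - 1) = u ^ k * u ^ (r - 1) := by
        rw [add_sub_assoc, Real.rpow_add hu, Real.rpow_natCast]
      simp only [poissonWeight]
      rw [hexp, hpow, mul_pow]
      ring
    _ = _ := by
      rw [MeasureTheory.integral_const_mul, hint, Real.Gamma_nat_eq_factorial, one_div_one_div,
        Real.rpow_add hp, Real.rpow_natCast, div_pow]
      field_simp

/-- Fix r > 0 and x > 0. The limit as p → 0+ of the sum over nonnegative integers k with
k·p ≤ x of Γ(k+r)/(Γ(r)·Γ(k+1)) · p^r · (1−p)^k equals (1/Γ(r))·∫₀^x u^(r−1)·e^(−u) du: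
if X ~ NegBinom(r, p), then p·X converges in distribution to Gamma(r, 1) as p → 0+. -/
theorem negbinom_scaled_tendsto_gamma (r x : ℝ) (hr : 0 < r) (hx : 0 < x) :
    Tendsto
      (fun p : ℝ =>
        ∑' k : ℕ,
          if (k : ℝ) * p ≤ x then
            Real.Gamma (k + r) / (Real.Gamma r * Real.Gamma (k + 1)) * p ^ r * (1 - p) ^ k
          else 0)
      (𝓝[>] 0)
      (𝓝 ((1 / Real.Gamma r) * ∫ u in (0 : ℝ)..x, u ^ (r - 1) * Real.exp (-u))) := by
  have hp01 : Ioo (0 : ℝ) 1 ∈ 𝓝[>] 0 := Ioo_mem_nhdsGT one_pos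
  have key : Tendsto (fun p : ℝ => ∫ u in Ioi (0 : ℝ), u ^ (r - 1) * Real.exp (-u) *
        ∑ k ∈ Finset.range (⌊x / p⌋₊ + 1), poissonWeight (u * ((1 - p) / p)) k)
      (𝓝[>] 0)
      (𝓝 (∫ u in Ioi (0 : ℝ), u ^ (r - 1) * Real.exp (-u) * (Iic x).indicator 1 u)) := by
    refine MeasureTheory.tendsto_integral_filter_of_dominated_convergence
      (fun u => u ^ (r - 1) * Real.exp (-u)) (Eventually.of_forall fun p => ?_) ?_
      (integrableOn_rpow_mul_exp_neg hr) ?_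
    · refine (integrableOn_rpow_mul_exp_neg hr).aestronglyMeasurable.mul
        (Continuous.aestronglyMeasurable ?_)
      exact continuous_finsetSum _ fun k _ =>
        (continuous_poissonWeight k).comp (continuous_id.mul continuous_const)
    · filter_upwards [hp01] with p ⟨hp, hp1⟩
      filter_upwards [MeasureTheory.ae_restrict_mem measurableSet_Ioi] with u hu
      have hu' : 0 < u := hu
      have hm : 0 ≤ u * ((1 - p) / p) := mul_nonneg hu'.le (div_nonneg (by linarith) hp.le)
      have hs := Finset.sum_nonneg fun k (_ : k ∈ Finset.range (⌊x / p⌋₊ + 1)) =>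
        poissonWeight_nonneg hm k
      rw [Real.norm_of_nonneg (by positivity)]
      exact mul_le_of_le_one_right (by positivity) (sum_poissonWeight_le_one hm _)
    · filter_upwards [MeasureTheory.ae_restrict_mem measurableSet_Ioi,
        MeasureTheory.Measure.ae_ne _ x] with u hu hux
      exact (tendsto_sum_poissonWeight hu hx hux).const_mul _
  have hlim : ∫ u in Ioi (0 : ℝ), u ^ (r - 1) * Real.exp (-u) * (Iic x).indicator 1 u =
      ∫ u in (0 : ℝ)..x, u ^ (r - 1) * Real.exp (-u) := by
    rw [intervalIntegral.integral_of_le hx.le, ← Ioi_inter_Iic,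
      ← MeasureTheory.setIntegral_indicator measurableSet_Iic]
    congr with u
    by_cases hu : u ∈ Iic x <;> simp [hu]
  rw [hlim] at key
  refine (key.const_mul (1 / Real.Gamma r)).congr' ?_
  filter_upwards [hp01] with p ⟨hp, hp1⟩
  have hc : 0 ≤ (1 - p) / p := div_nonneg (by linarith) hp.le
  simp_rw [Finset.mul_sum]
  rw [MeasureTheory.integral_finsetSum _ fun k _ => integrableOn_gamma_mul_poissonWeight hr hc k,
    tsum_eq_sum (s := Finset.range (⌊x / p⌋₊ + 1)) fun k hk =>
      if_neg (mt (mem_range_floor_div_iff hp hx.le k).mpr hk), Finset.mul_sum]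
  refine Finset.sum_congr rfl fun k hk => ?_
  rw [if_pos ((mem_range_floor_div_iff hp hx.le k).mp hk),
    integral_gamma_mul_poissonWeight hr hp]
  field_simp
end

section
/- For every ρ > 0, γ > 0 and s ≥ 0, the series identity log((1+ρ)/ρ − (1/ρ)·exp(−ρ·γ·s/(1+ρ))) = Σ_{k=1}^∞ (1/(k·(1+ρ)^k)) · (1 − exp(−ρ·k·γ·s/(1+ρ))) holds, the series on the right-hand side being convergent. -/
open Filter Topology Set

/-- For every ρ > 0, γ > 0 and s ≥ 0, the series identity
log((1+ρ)/ρ − (1/ρ)·exp(−ρ·γ·s/(1+ρ)))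
  = Σ_{k=1}^∞ (1/(k·(1+ρ)^k))·(1 − exp(−ρ·k·γ·s/(1+ρ)))
holds, the series on the right-hand side being convergent. -/
theorem cel_levy_series_identity (ρ γ s : ℝ) (hρ : 0 < ρ) (hγ : 0 < γ) (hs : 0 ≤ s) :
    Summable
      (fun k : ℕ =>
        (1 / ((k + 1 : ℕ) * (1 + ρ) ^ (k + 1))) *
          (1 - Real.exp (-(ρ * (k + 1 : ℕ) * γ * s / (1 + ρ))))) ∧
    Real.log ((1 + ρ) / ρ - (1 / ρ) * Real.exp (-(ρ * γ * s / (1 + ρ)))) =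
      ∑' k : ℕ,
        (1 / ((k + 1 : ℕ) * (1 + ρ) ^ (k + 1))) *
          (1 - Real.exp (-(ρ * (k + 1 : ℕ) * γ * s / (1 + ρ)))) := by
  set e := Real.exp (-(ρ * γ * s / (1 + ρ))) with he
  have h1ρ : 0 < 1 + ρ := by linarith
  have he0 : 0 < e := Real.exp_pos _
  have he1 : e ≤ 1 := Real.exp_le_one_iff.2 (neg_nonpos.2 (by positivity))
  have hx : |1 / (1 + ρ)| < 1 := by
    rw [abs_of_pos (by positivity), div_lt_one h1ρ]
    linarith
  have hy : |e / (1 + ρ)| < 1 := by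
    rw [abs_of_pos (by positivity), div_lt_one h1ρ]
    linarith
  have hsum := (Real.hasSum_pow_div_log_of_abs_lt_one hx).sub
    (Real.hasSum_pow_div_log_of_abs_lt_one hy)
  have hlog : -Real.log (1 - 1 / (1 + ρ)) - -Real.log (1 - e / (1 + ρ)) =
      Real.log ((1 + ρ) / ρ - (1 / ρ) * e) := by
    rw [neg_sub_neg, ← Real.log_div (sub_pos.2 (abs_lt.1 hy).2).ne'
      (sub_pos.2 (abs_lt.1 hx).2).ne']
    congr 1
    have hden : 1 - 1 / (1 + ρ) = ρ / (1 + ρ) := by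
      field_simp
      ring
    rw [hden]
    field_simp
  have hterm (k : ℕ) : (1 / (1 + ρ)) ^ (k + 1) / ((k : ℝ) + 1) -
      (e / (1 + ρ)) ^ (k + 1) / ((k : ℝ) + 1) =
      (1 / ((k + 1 : ℕ) * (1 + ρ) ^ (k + 1))) *
        (1 - Real.exp (-(ρ * (k + 1 : ℕ) * γ * s / (1 + ρ)))) := by
    have hexp : Real.exp (-(ρ * (k + 1 : ℕ) * γ * s / (1 + ρ))) = e ^ (k + 1) := by
      rw [he, ← Real.exp_nat_mul]
      congr 1
      ring
    rw [hexp, div_pow, div_pow, one_pow]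
    push_cast
    field_simp
  simp only [hterm, hlog] at hsum
  exact ⟨hsum.summable, hsum.tsum_eq.symm⟩
end

section
/- For every ξ > 0, γ > 0, ρ > 0 and s ≥ 0, the integral ∫₀^∞ (1 − exp(−s·u)) · (γ/ξ)·((ρ+1)/γ)^(ρ+1)/Γ(ρ+1) · u^(ρ−1)·exp(−(ρ+1)·u/γ) du equals ((ρ+1)/(ρξ))·(1 − (1 + γ·s/(ρ+1))^(−ρ)). -/
open Filter Topology Set MeasureTheory

/-- The Gamma integrand `t ^ (a - 1) * exp (-(r * t))` is integrable on the positive half-line. -/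
theorem integrableOn_rpow_mul_exp_neg_mul_Ioi {a r : ℝ} (ha : 0 < a) (hr : 0 < r) :
    IntegrableOn (fun t : ℝ => t ^ (a - 1) * Real.exp (-(r * t))) (Ioi 0) := by
  refine .of_integral_ne_zero ?_
  rw [Real.integral_rpow_mul_exp_neg_mul_Ioi ha hr]
  have := Real.Gamma_pos_of_pos ha
  positivity

/-- The Laplace exponent of the Lévy density `t ^ (a - 1) * exp (-(r * t))`. -/
theorem integral_one_sub_exp_mul_rpow_mul_exp_neg_mul_Ioi {a r s : ℝ} (ha : 0 < a) (hr : 0 < r)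
    (hs : 0 ≤ s) :
    ∫ t in Ioi (0 : ℝ), (1 - Real.exp (-(s * t))) * (t ^ (a - 1) * Real.exp (-(r * t))) =
      Real.Gamma a / r ^ a * (1 - (1 + s / r) ^ (-a)) := by
  have hrs : 0 < r + s := by positivity
  have hsplit (t : ℝ) : (1 - Real.exp (-(s * t))) * (t ^ (a - 1) * Real.exp (-(r * t))) =
      t ^ (a - 1) * Real.exp (-(r * t)) - t ^ (a - 1) * Real.exp (-((r + s) * t)) := by
    rw [show -((r + s) * t) = -(s * t) + -(r * t) by ring, Real.exp_add]
    ring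
  simp_rw [hsplit]
  rw [integral_sub (integrableOn_rpow_mul_exp_neg_mul_Ioi ha hr)
      (integrableOn_rpow_mul_exp_neg_mul_Ioi ha hrs),
    Real.integral_rpow_mul_exp_neg_mul_Ioi ha hr, Real.integral_rpow_mul_exp_neg_mul_Ioi ha hrs,
    show r + s = r * (1 + s / r) by field_simp, one_div, one_div, Real.inv_rpow hr.le,
    Real.inv_rpow (by positivity), Real.mul_rpow hr.le (by positivity),
    Real.rpow_neg (by positivity), mul_inv]
  ring

/-- For every ξ > 0, γ > 0, ρ > 0 and s ≥ 0,
∫₀^∞ (1 − exp(−s·u))·(γ/ξ)·((ρ+1)/γ)^(ρ+1)/Γ(ρ+1)·u^(ρ−1)·exp(−(ρ+1)·u/γ) du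
  = ((ρ+1)/(ρξ))·(1 − (1 + γ·s/(ρ+1))^(−ρ)):
the Lévy–Khintchine representation of the compound Poisson–Gamma Laplace exponent Ψ_ρ. -/
theorem psi_rho_levy_khintchine (ξ γ ρ s : ℝ) (hξ : 0 < ξ) (hγ : 0 < γ) (hρ : 0 < ρ)
    (hs : 0 ≤ s) :
    (∫ u in Ioi (0 : ℝ),
        (1 - Real.exp (-(s * u))) *
          ((γ / ξ) * ((ρ + 1) / γ) ^ (ρ + 1) / Real.Gamma (ρ + 1) * u ^ (ρ - 1) *
            Real.exp (-((ρ + 1) * u / γ)))) =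
      ((ρ + 1) / (ρ * ξ)) * (1 - (1 + γ * s / (ρ + 1)) ^ (-ρ)) := by
  have hb : 0 < (ρ + 1) / γ := by positivity
  have hrearrange (u : ℝ) : (1 - Real.exp (-(s * u))) *
      ((γ / ξ) * ((ρ + 1) / γ) ^ (ρ + 1) / Real.Gamma (ρ + 1) * u ^ (ρ - 1) *
        Real.exp (-((ρ + 1) * u / γ))) =
      (γ / ξ) * ((ρ + 1) / γ) ^ (ρ + 1) / Real.Gamma (ρ + 1) *
        ((1 - Real.exp (-(s * u))) * (u ^ (ρ - 1) * Real.exp (-((ρ + 1) / γ * u)))) := by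
    rw [show (ρ + 1) * u / γ = (ρ + 1) / γ * u by ring]
    ring
  simp_rw [hrearrange]
  rw [integral_const_mul, integral_one_sub_exp_mul_rpow_mul_exp_neg_mul_Ioi hρ hb hs,
    show s / ((ρ + 1) / γ) = γ * s / (ρ + 1) by field_simp, ← mul_assoc]
  congr 1
  have hΓ := (Real.Gamma_pos_of_pos hρ).ne'
  have hpow := (Real.rpow_pos_of_pos hb ρ).ne'
  rw [Real.rpow_add_one hb.ne', Real.Gamma_add_one hρ.ne']
  generalize ((ρ + 1) / γ) ^ ρ = p at hpow ⊢
  field_simp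
end

section
/- For every γ > 0 and every s > 0, the strict chain of inequalities (1/γ)·log(2 − exp(−γ·s)) < s/(γ·s + 1) < (1/γ)·(1 − exp(−γ·s)) < (1/γ)·log(γ·s + 1) < s holds; at s = 0 all five expressions are equal (to 0). -/
open Filter Topology Set

/-- The derivative criterion on `[0, ∞)` with explicit derivatives: a function with positive
derivative on `(0, ∞)` exceeds its value at `0`. -/
lemma lt_of_hasDerivAt_pos {f f' : ℝ → ℝ} (hd : ∀ x, 0 ≤ x → HasDerivAt f (f' x) x)
    (hpos : ∀ x, 0 < x → 0 < f' x) {t : ℝ} (ht : 0 < t) : f 0 < f t := by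
  refine strictMonoOn_of_deriv_pos (convex_Ici 0)
    (fun x hx => (hd x hx).continuousAt.continuousWithinAt) (fun x hx => ?_)
    self_mem_Ici ht.le ht
  rw [interior_Ici] at hx
  rw [(hd x (le_of_lt hx)).deriv]
  exact hpos x hx

lemma exp_neg_lt_one_div_add_one {t : ℝ} (ht : 0 < t) : Real.exp (-t) < 1 / (t + 1) := by
  rw [Real.exp_neg, ← one_div]
  exact one_div_lt_one_div_of_lt (by positivity) (Real.add_one_lt_exp ht.ne')

lemma exp_neg_lt_exp_div_add_one_div_sq {t : ℝ} (ht : 0 < t) :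
    Real.exp (-t) < Real.exp (t / (t + 1)) * (1 / (t + 1) ^ 2) := by
  have h1 : 0 < t + 1 := by positivity
  have hlog := Real.self_lt_sinh_iff.2 (Real.log_pos (show 1 < t + 1 by linarith))
  rw [Real.sinh_log h1] at hlog
  have hdiv : t / (t + 1) = 1 - (t + 1)⁻¹ := by field_simp; ring
  have hsq : 1 / (t + 1) ^ 2 = Real.exp (-(2 * Real.log (t + 1))) := by
    rw [Real.exp_neg, two_mul, Real.exp_add, Real.exp_log h1, one_div, sq]
  rw [hsq, ← Real.exp_add, Real.exp_lt_exp]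
  linarith

lemma two_lt_exp_div_add_one_add_exp_neg {t : ℝ} (ht : 0 < t) :
    2 < Real.exp (t / (t + 1)) + Real.exp (-t) := by
  have h := lt_of_hasDerivAt_pos (f := fun x => Real.exp (x / (x + 1)) + Real.exp (-x))
    (f' := fun x => Real.exp (x / (x + 1)) * (1 / (x + 1) ^ 2) - Real.exp (-x))
    (fun x hx => ?_) (fun x hx => sub_pos.2 (exp_neg_lt_exp_div_add_one_div_sq hx)) ht
  · norm_num at h
    linarith
  · have h1 : x + 1 ≠ 0 := by positivity
    refine (((hasDerivAt_id x).div ((hasDerivAt_id x).add_const 1) h1).exp.add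
      (hasDerivAt_id x).neg.exp).congr_deriv ?_
    simp only [id, Pi.div_apply, Pi.neg_apply]
    ring

lemma one_sub_exp_neg_lt_log_add_one {t : ℝ} (ht : 0 < t) :
    1 - Real.exp (-t) < Real.log (t + 1) := by
  have h := lt_of_hasDerivAt_pos (f := fun x => Real.log (x + 1) + Real.exp (-x))
    (f' := fun x => 1 / (x + 1) - Real.exp (-x))
    (fun x hx => ?_) (fun x hx => sub_pos.2 (exp_neg_lt_one_div_add_one hx)) ht
  · norm_num at h
    linarith
  · have h1 : x + 1 ≠ 0 := by positivity
    refine ((((hasDerivAt_id x).add_const 1).log h1).add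
      (hasDerivAt_id x).neg.exp).congr_deriv ?_
    simp only [id, Pi.neg_apply]
    ring

/-- For every γ > 0 and every s > 0, the strict chain of inequalities
(1/γ)·log(2 − exp(−γs)) < s/(γs+1) < (1/γ)·(1 − exp(−γs)) < (1/γ)·log(γs+1) < s
holds (CEL < LFR < EXP < LOG < ℓ₁, with ξ = γ); at s = 0 all five expressions
are equal to 0. -/
theorem penalty_chain_inequalities (γ : ℝ) (hγ : 0 < γ) :
    (∀ s : ℝ, 0 < s →
      (1 / γ) * Real.log (2 - Real.exp (-(γ * s))) < s / (γ * s + 1) ∧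
      s / (γ * s + 1) < (1 / γ) * (1 - Real.exp (-(γ * s))) ∧
      (1 / γ) * (1 - Real.exp (-(γ * s))) < (1 / γ) * Real.log (γ * s + 1) ∧
      (1 / γ) * Real.log (γ * s + 1) < s) ∧
    ((1 / γ) * Real.log (2 - Real.exp (-(γ * 0))) = 0 ∧
      (0 : ℝ) / (γ * 0 + 1) = 0 ∧
      (1 / γ) * (1 - Real.exp (-(γ * 0))) = 0 ∧
      (1 / γ) * Real.log (γ * 0 + 1) = 0) := by
  refine ⟨fun s hs => ?_, by norm_num⟩
  have ht : 0 < γ * s := mul_pos hγ hs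
  have hinv : 0 < 1 / γ := one_div_pos.2 hγ
  have hs_eq : s = 1 / γ * (γ * s) := by field_simp
  have hdiv : s / (γ * s + 1) = 1 / γ * (γ * s / (γ * s + 1)) := by field_simp
  rw [hdiv]
  refine ⟨mul_lt_mul_of_pos_left ?_ hinv, mul_lt_mul_of_pos_left ?_ hinv,
    mul_lt_mul_of_pos_left (one_sub_exp_neg_lt_log_add_one ht) hinv, ?_⟩
  · have hexp : Real.exp (-(γ * s)) < 1 := Real.exp_lt_one_iff.2 (by linarith)
    rw [Real.log_lt_iff_lt_exp (by linarith)]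
    linarith [two_lt_exp_div_add_one_add_exp_neg ht]
  · have hfrac : γ * s / (γ * s + 1) = 1 - 1 / (γ * s + 1) := by field_simp; ring
    linarith [exp_neg_lt_one_div_add_one ht]
  · have hlog := Real.log_lt_sub_one_of_pos (show 0 < γ * s + 1 by linarith) (by linarith)
    calc 1 / γ * Real.log (γ * s + 1) < 1 / γ * (γ * s) :=
          mul_lt_mul_of_pos_left (by linarith) hinv
      _ = s := hs_eq.symm
end

section
/- Let X be a real n × p matrix (with p ≥ 1) whose columns are linearly independent (i.e., the linear map b ↦ X·b from ℝ^p to ℝ^n is injective), let y ∈ ℝ^n, let t₁, …, t_p ≥ 0, let α ≥ 0, let β > 0, and let Ψ : [0,∞) → [0,∞) be a Borel measurable nonnegative function. Then the double integral over σ ∈ (0,∞) and b ∈ ℝ^p of σ^{−((n+α+2p)/2 + 1)} · exp(−(‖y − X·b‖₂² + β)/(2σ)) · Π_{j=1}^p exp(−t_j·Ψ(|b_j|/σ)) db dσ is finite. In particular, the joint posterior density p(b, σ | t, y), proportional to this integrand, is proper. -/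
open Filter Topology Set MeasureTheory

/-- The least squares residual controls the distance of `b` to a fixed centre when the columns of
`X` are linearly independent. -/
lemma exists_mul_sum_sq_sub_le_residual {n p : ℕ} (X : Matrix (Fin n) (Fin p) ℝ)
    (hX : Function.Injective fun b : Fin p → ℝ => X.mulVec b) (y : Fin n → ℝ) :
    ∃ c : ℝ, 0 < c ∧ ∃ m : Fin p → ℝ, ∀ b : Fin p → ℝ,
      c * ∑ j, (b j - m j) ^ 2 ≤ ∑ i, (y i - X.mulVec b i) ^ 2 := by
  obtain ⟨g, hg⟩ :=
    X.mulVecLin.exists_leftInverse_of_injective (LinearMap.ker_eq_bot.mpr hX)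
  set L := LinearMap.toMatrix' g
  set K : ℝ := ∑ j, ∑ i, L j i ^ 2
  have hK : 0 ≤ K := by positivity
  refine ⟨(K + 1)⁻¹, by positivity, L.mulVec y, fun b => ?_⟩
  have hr : 0 ≤ ∑ i, (y i - X.mulVec b i) ^ 2 := by positivity
  have hb : b = L.mulVec (X.mulVec b) :=
    (LinearMap.congr_fun hg b).symm.trans (LinearMap.toMatrix'_mulVec g _).symm
  have hle : ∑ j, (b j - L.mulVec y j) ^ 2 ≤ K * ∑ i, (y i - X.mulVec b i) ^ 2 := by
    rw [Finset.sum_mul]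
    refine Finset.sum_le_sum fun j _ => ?_
    have : (b j - L.mulVec y j) ^ 2 = (∑ i, L j i * (y i - X.mulVec b i)) ^ 2 := by
      conv_lhs => rw [hb]
      simp only [Matrix.mulVec, dotProduct, mul_sub, Finset.sum_sub_distrib]
      ring
    rw [this]
    exact Finset.sum_mul_sq_le_sq_mul_sq _ _ _
  rw [inv_mul_le_iff₀ (by positivity)]
  nlinarith

/-- The integral of a product of translated Gaussians with the same precision. -/
lemma lintegral_prod_exp_neg_mul_sq_sub {ι : Type*} [Fintype ι] {a : ℝ} (ha : 0 < a)
    (m : ι → ℝ) :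
    ∫⁻ b : ι → ℝ, ENNReal.ofReal (∏ j, Real.exp (-a * (b j - m j) ^ 2)) =
      ENNReal.ofReal (√(Real.pi / a) ^ Fintype.card ι) := by
  have hint : ∀ j, Integrable fun x : ℝ => Real.exp (-a * (x - m j) ^ 2) := fun j =>
    (integrable_exp_neg_mul_sq ha).comp_sub_right (m j)
  rw [volume_pi, ← ofReal_integral_eq_lintegral_ofReal (Integrable.fintype_prod hint)
      (ae_of_all _ fun b => by positivity),
    integral_fintype_prod_eq_prod fun j (x : ℝ) => Real.exp (-a * (x - m j) ^ 2)]
  congr 1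
  refine (Finset.prod_congr rfl fun j _ =>
    (integral_sub_right_eq_self (fun x : ℝ => Real.exp (-a * x ^ 2)) (m j)).trans
      (integral_gaussian a)).trans ?_
  rw [Finset.prod_const, Finset.card_univ]

/-- The unnormalized inverse Gamma density is integrable. -/
lemma integrableOn_rpow_mul_exp_neg_div {q r : ℝ} (hq : 0 < q) (hr : 0 < r) :
    IntegrableOn (fun x : ℝ => x ^ (-(q + 1)) * Real.exp (-r / x)) (Ioi 0) := by
  have h := integrableOn_rpow_mul_exp_neg_mul_rpow (s := q - 1) (p := 1) (by linarith) one_pos hr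
  rw [← integrableOn_Ioi_comp_rpow_iff _ (by norm_num : (-1 : ℝ) ≠ 0)] at h
  refine h.congr_fun (fun x (hx : 0 < x) => ?_) measurableSet_Ioi
  simp only [abs_neg, abs_one, one_mul, smul_eq_mul, Real.rpow_one]
  rw [← Real.rpow_mul hx.le, ← mul_assoc, ← Real.rpow_add hx, Real.rpow_neg_one, div_eq_mul_inv]
  ring_nf

/-- Let X be a real n × p matrix (p ≥ 1) with linearly independent columns, y ∈ ℝⁿ,
t₁,…,t_p ≥ 0, α ≥ 0, β > 0, and Ψ : [0,∞) → [0,∞) Borel measurable and nonnegative. Then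
∫₀^∞ ∫_{ℝ^p} σ^{−((n+α+2p)/2+1)} · exp(−(‖y − X·b‖₂² + β)/(2σ)) ·
  Π_j exp(−t_j·Ψ(|b_j|/σ)) db dσ < ∞; in particular the joint posterior density
p(b, σ | t, y) is proper. -/
theorem posterior_b_sigma_proper (n p : ℕ) (hp : 1 ≤ p) (X : Matrix (Fin n) (Fin p) ℝ)
    (hX : Function.Injective fun b : Fin p → ℝ => X.mulVec b)
    (y : Fin n → ℝ) (t : Fin p → ℝ) (ht : ∀ j, 0 ≤ t j)
    (α β : ℝ) (hα : 0 ≤ α) (hβ : 0 < β)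
    (Ψ : ℝ → ℝ) (hΨm : Measurable Ψ) (hΨ : ∀ s, 0 ≤ s → 0 ≤ Ψ s) :
    (∫⁻ σ in Ioi (0 : ℝ),
        ∫⁻ b : Fin p → ℝ,
          ENNReal.ofReal
            (σ ^ (-(((n : ℝ) + α + 2 * (p : ℝ)) / 2 + 1)) *
              Real.exp (-((∑ i, (y i - X.mulVec b i) ^ 2) + β) / (2 * σ)) *
              ∏ j, Real.exp (-(t j * Ψ (|b j| / σ))))) < ⊤ := by
  obtain ⟨c, hc, m, hm⟩ := exists_mul_sum_sq_sub_le_residual X hX y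
  set q : ℝ := ((n : ℝ) + α + p) / 2
  have hq : 0 < q := by positivity
  have hfin := ((integrableOn_rpow_mul_exp_neg_div hq (half_pos hβ)).const_mul
    (√(2 * Real.pi / c) ^ p)).lintegral_lt_top
  refine (setLIntegral_mono' measurableSet_Ioi fun σ (hσ : 0 < σ) => ?_).trans_lt hfin
  set A : ℝ := σ ^ (-(((n : ℝ) + α + 2 * (p : ℝ)) / 2 + 1)) * Real.exp (-(β / 2) / σ)
  have hA : 0 ≤ A := by positivity
  calc _ ≤ ∫⁻ b : Fin p → ℝ, ENNReal.ofReal A *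
          ENNReal.ofReal (∏ j, Real.exp (-(c / (2 * σ)) * (b j - m j) ^ 2)) := by
        refine lintegral_mono fun b => ?_
        rw [← ENNReal.ofReal_mul hA]
        refine ENNReal.ofReal_le_ofReal ?_
        have hprod : ∏ j, Real.exp (-(t j * Ψ (|b j| / σ))) ≤ 1 :=
          Finset.prod_le_one (fun j _ => by positivity) fun j _ => Real.exp_le_one_iff.mpr <|
            neg_nonpos.mpr <| mul_nonneg (ht j) (hΨ _ (by positivity))
        refine (mul_le_of_le_one_right (by positivity) hprod).trans ?_
        rw [mul_assoc, ← Real.exp_sum, ← Real.exp_add, ← Finset.mul_sum]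
        gcongr
        calc -(∑ i, (y i - X.mulVec b i) ^ 2 + β) / (2 * σ)
            ≤ -(c * ∑ j, (b j - m j) ^ 2 + β) / (2 * σ) := by gcongr; exact hm b
          _ = _ := by field_simp; ring
    _ = ENNReal.ofReal (A * √(Real.pi / (c / (2 * σ))) ^ p) := by
        rw [lintegral_const_mul' _ _ ENNReal.ofReal_ne_top,
          lintegral_prod_exp_neg_mul_sq_sub (by positivity), Fintype.card_fin,
          ENNReal.ofReal_mul hA]
    _ = _ := by
        congr 1
        have hsqrt : √(Real.pi / (c / (2 * σ))) ^ p =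
            √(2 * Real.pi / c) ^ p * σ ^ ((p : ℝ) / 2) := by
          rw [show Real.pi / (c / (2 * σ)) = 2 * Real.pi / c * σ by field_simp,
            Real.sqrt_mul (by positivity), mul_pow, Real.sqrt_eq_rpow σ,
            ← Real.rpow_mul_natCast hσ.le]
          ring_nf
        have hpow : σ ^ (-(q + 1)) =
            σ ^ (-(((n : ℝ) + α + 2 * (p : ℝ)) / 2 + 1)) * σ ^ ((p : ℝ) / 2) := by
          rw [← Real.rpow_add hσ]
          congr 1
          ring
        rw [hsqrt, hpow]
        ring
end
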